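/- Let (Σ_M, σ) be an irreducible topological Markov chain with ultrametric d_λ, λ > 1, Q a periodic orbit, and G^s(Q) the stable groupoid with the ultrametric D_{s,λ}. Then: (1) for every c ∈ G^s(Q) and every integer n ≥ c_s(c), the source map (x,y) ↦ y restricted to the base set V^s(c, λ^{−n−1}, n) is an isometry onto its image, where G^s(Q) carries D_{s,λ} and X^u(Q) carries the metric D̃_{s,λ} defined by D̃_{s,λ}(x,y) = d_λ(x,y) if y ∈ X^u(x, λ^{−1}) and D̃_{s,λ}(x,y) = 1 otherwise; (2) the inversion map (x,y) ↦ (y,x) is an isometry of (G^s(Q), D_{s,λ}). -/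

import Mathlib

open scoped Classical

/-- A sequence `x : ℤ → Fin m` is allowable for the 0-1 matrix `M` if all its
transitions are allowed. -/
def IsMarkov {m : ℕ} (M : Fin m → Fin m → Bool) (x : ℤ → Fin m) : Prop :=
  ∀ i : ℤ, M (x i) (x (i + 1)) = true

/-- The topological Markov chain `Σ_M` of allowable bi-infinite sequences. -/
def TMC {m : ℕ} (M : Fin m → Fin m → Bool) : Type := {x : ℤ → Fin m // IsMarkov M x}

namespace TMC

variable {m : ℕ} {M : Fin m → Fin m → Bool}

instance : TopologicalSpace (TMC M) :=
  inferInstanceAs (TopologicalSpace {x : ℤ → Fin m // IsMarkov M x})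

/-- The shift homeomorphism `σ(x)_i = x_{i+1}`. -/
def shift (M : Fin m → Fin m → Bool) (x : TMC M) : TMC M :=
  ⟨fun i => x.1 (i + 1), fun i => x.2 (i + 1)⟩

/-- The inverse shift `σ⁻¹(x)_i = x_{i-1}`. -/
def shiftInv (M : Fin m → Fin m → Bool) (x : TMC M) : TMC M :=
  ⟨fun i => x.1 (i - 1), fun i => by
    have h : i + 1 - 1 = i - 1 + 1 := by ring
    show M (x.1 (i - 1)) (x.1 (i + 1 - 1)) = true
    rw [h]
    exact x.2 (i - 1)⟩

/-- The ultrametric `d_λ(x,y) = inf{λ^{-n} : n ≥ 0, xᵢ = yᵢ for |i| < n}`. -/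
noncomputable def dlam (lam : ℝ) (x y : TMC M) : ℝ :=
  sInf {r : ℝ | ∃ n : ℕ, (∀ i : ℤ, |i| < (n : ℤ) → x.1 i = y.1 i) ∧ r = lam ^ (-(n : ℤ))}

/-- The bracket (splicing) map: `[x,y]_n = y_n` for `n ≤ 0` and `[x,y]_n = x_n` for
`n ≥ 1`, defined when `x₀ = y₀` (junk value `x` otherwise). -/
noncomputable def bracket (x y : TMC M) : TMC M :=
  if h : x.1 0 = y.1 0 then
    ⟨fun n => if n ≤ 0 then y.1 n else x.1 n, by
      intro i
      by_cases h1 : i + 1 ≤ 0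
      · have h2 : i ≤ 0 := by omega
        simp only [if_pos h1, if_pos h2]
        exact y.2 i
      · by_cases h2 : i ≤ 0
        · have h3 : i = 0 := by omega
          subst h3
          simp only [if_neg h1, le_refl, if_pos]
          rw [← h]
          exact x.2 0
        · simp only [if_neg h1, if_neg h2]
          exact x.2 i⟩
  else x

/-- The local stable set `X^s(x,ε) = {y : d_λ(x,y) < ε, [x,y] = y}`. -/
def locStable (lam : ℝ) (x : TMC M) (ε : ℝ) : Set (TMC M) :=
  {y | dlam lam x y < ε ∧ bracket x y = y}

/-- The local unstable set `X^u(x,ε) = {y : d_λ(x,y) < ε, [y,x] = y}`. -/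
def locUnstable (lam : ℝ) (x : TMC M) (ε : ℝ) : Set (TMC M) :=
  {y | dlam lam x y < ε ∧ bracket y x = y}

/-- The global stable set `X^s(x) = {y : d_λ(σⁿx, σⁿy) → 0 as n → +∞}`. -/
def globStable (lam : ℝ) (x : TMC M) : Set (TMC M) :=
  {y | Filter.Tendsto (fun n : ℕ => dlam lam ((shift M)^[n] x) ((shift M)^[n] y))
        Filter.atTop (nhds 0)}

/-- The global unstable set `X^u(x) = {y : d_λ(σⁿx, σⁿy) → 0 as n → −∞}`. -/
def globUnstable (lam : ℝ) (x : TMC M) : Set (TMC M) :=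
  {y | Filter.Tendsto (fun n : ℕ => dlam lam ((shiftInv M)^[n] x) ((shiftInv M)^[n] y))
        Filter.atTop (nhds 0)}

/-- The (forward) `σ`-orbit of a point. -/
def orbit (q : TMC M) : Set (TMC M) := {y | ∃ k : ℕ, (shift M)^[k] q = y}

/-- `X^u(Q) = ∪_{q' ∈ Q} X^u(q')` for `Q` the orbit of `q`. -/
def XuQ (lam : ℝ) (q : TMC M) : Set (TMC M) := ⋃ q' ∈ orbit q, globUnstable lam q'

/-- The stable groupoid `G^s(Q) = {(x,y) : x,y ∈ X^u(Q), y ∈ X^s(x)}`. -/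
def GsQ (lam : ℝ) (q : TMC M) : Set (TMC M × TMC M) :=
  {a | a.1 ∈ XuQ lam q ∧ a.2 ∈ XuQ lam q ∧ a.2 ∈ globStable lam a.1}

/-- `c_s(a)`: the least `N ≥ 0` with `σ^N(a₂) ∈ X^s(σ^N(a₁), λ⁻¹)`. -/
noncomputable def cs (lam : ℝ) (a : TMC M × TMC M) : ℕ :=
  sInf {N : ℕ | (shift M)^[N] a.2 ∈ locStable lam ((shift M)^[N] a.1) lam⁻¹}

/-- The stable holonomy map `h^s(z) = σ^{-N}[σ^N(z), σ^N(c₁)]`. -/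
noncomputable def holS (N : ℕ) (c₁ z : TMC M) : TMC M :=
  (shiftInv M)^[N] (bracket ((shift M)^[N] z) ((shift M)^[N] c₁))

/-- The base set `V^s(c, η, N) = {(h^s(z), z) : z ∈ X^u(c₂, η)}`. -/
def Vs (lam : ℝ) (c : TMC M × TMC M) (η : ℝ) (N : ℕ) : Set (TMC M × TMC M) :=
  {b | b.2 ∈ locUnstable lam c.2 η ∧ b.1 = holS N c.1 b.2}

/-- `d_{s,λ}` on the stable groupoid. -/
noncomputable def dsl (lam : ℝ) (a b : TMC M × TMC M) : ℝ :=
  if b.2 ∈ locUnstable lam a.2 lam⁻¹ ∧ b.1 ∈ locUnstable lam a.1 lam⁻¹ then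
    max (dlam lam a.1 b.1) (dlam lam a.2 b.2)
  else 1

/-- The groupoid ultrametric `D_{s,λ}`. -/
noncomputable def Dsl (lam : ℝ) (a b : TMC M × TMC M) : ℝ :=
  if cs lam a = cs lam b then dsl lam a b else 1

/-- The induced metric `D̃_{s,λ}` on the unit space `X^u(Q)`. -/
noncomputable def DslUnits (lam : ℝ) (x y : TMC M) : ℝ :=
  if y ∈ locUnstable lam x lam⁻¹ then dlam lam x y else 1

end TMC

namespace TMC

variable {m : ℕ} {M : Fin m → Fin m → Bool}

theorem ext_apply {x y : TMC M} (h : ∀ i, x.1 i = y.1 i) : x = y :=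
  Subtype.ext (funext h)

theorem shift_iterate_apply (n : ℕ) (x : TMC M) (i : ℤ) :
    ((shift M)^[n] x).1 i = x.1 (i + n) := by
  induction n generalizing x with
  | zero => simp
  | succ n ih =>
    rw [Function.iterate_succ_apply, ih]
    change x.1 (i + n + 1) = _
    push_cast
    rw [add_assoc]

theorem shiftInv_iterate_apply (n : ℕ) (x : TMC M) (i : ℤ) :
    ((shiftInv M)^[n] x).1 i = x.1 (i - n) := by
  induction n generalizing x with
  | zero => simp
  | succ n ih =>
    rw [Function.iterate_succ_apply, ih]
    change x.1 (i - n - 1) = _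
    push_cast
    rw [sub_sub]

theorem bracket_apply {x y : TMC M} (h : x.1 0 = y.1 0) (i : ℤ) :
    (bracket x y).1 i = if i ≤ 0 then y.1 i else x.1 i := by
  exact congrFun (congrArg Subtype.val (dif_pos h)) i

theorem bracket_eq_right_iff {x y : TMC M} :
    bracket x y = y ↔ ∀ i : ℤ, 0 ≤ i → x.1 i = y.1 i := by
  constructor
  · intro h
    have h0 : x.1 0 = y.1 0 := by
      by_contra h0
      have hxy : x = y := (dif_neg h0).symm.trans h
      exact h0 (by rw [hxy])
    intro i hi
    rcases hi.eq_or_lt with rfl | hi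
    · exact h0
    · have := bracket_apply h0 i
      rwa [h, if_neg (not_le.mpr hi), eq_comm] at this
  · intro h
    refine ext_apply fun i => ?_
    rw [bracket_apply (h 0 le_rfl)]
    split_ifs with hi
    · rfl
    · exact h i (by omega)

theorem bracket_eq_left_iff {x y : TMC M} (h0 : y.1 0 = x.1 0) :
    bracket y x = y ↔ ∀ i : ℤ, i ≤ 0 → x.1 i = y.1 i := by
  constructor
  · intro h i hi
    have := bracket_apply h0 i
    rwa [h, if_pos hi, eq_comm] at this
  · intro h
    refine ext_apply fun i => ?_
    rw [bracket_apply h0]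
    split_ifs with hi
    · exact h i hi
    · rfl

theorem bddBelow_dlam_set {lam : ℝ} (hlam : 1 < lam) (x y : TMC M) :
    BddBelow {r : ℝ | ∃ n : ℕ, (∀ i : ℤ, |i| < (n : ℤ) → x.1 i = y.1 i) ∧
      r = lam ^ (-(n : ℤ))} := by
  refine ⟨0, ?_⟩
  rintro r ⟨n, -, rfl⟩
  positivity

theorem dlam_set_nonempty (lam : ℝ) (x y : TMC M) :
    {r : ℝ | ∃ n : ℕ, (∀ i : ℤ, |i| < (n : ℤ) → x.1 i = y.1 i) ∧
      r = lam ^ (-(n : ℤ))}.Nonempty :=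
  ⟨_, 0, fun i hi => absurd hi (not_lt.mpr (by simp)), rfl⟩

theorem dlam_lt_zpow_iff {lam : ℝ} (hlam : 1 < lam) (x y : TMC M) (k : ℕ) :
    dlam lam x y < lam ^ (-(k : ℤ)) ↔ ∀ i : ℤ, |i| ≤ k → x.1 i = y.1 i := by
  rw [dlam, csInf_lt_iff (bddBelow_dlam_set hlam x y) (dlam_set_nonempty lam x y)]
  constructor
  · rintro ⟨_, ⟨n, hn, rfl⟩, hlt⟩ i hi
    rw [zpow_lt_zpow_iff_right₀ hlam] at hlt
    exact hn i (by omega)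
  · intro h
    refine ⟨_, ⟨k + 1, fun i hi => h i (by push_cast at hi; omega), rfl⟩, ?_⟩
    rw [zpow_lt_zpow_iff_right₀ hlam]
    push_cast
    omega

theorem dlam_le_dlam {lam : ℝ} (hlam : 1 < lam) {x y z w : TMC M}
    (h : ∀ i, z.1 i = w.1 i → x.1 i = y.1 i) : dlam lam x y ≤ dlam lam z w := by
  refine csInf_le_csInf (bddBelow_dlam_set hlam x y) (dlam_set_nonempty lam z w) ?_
  rintro r ⟨n, hn, rfl⟩
  exact ⟨n, fun i hi => h i (hn i hi), rfl⟩

theorem mem_locStable_iff {lam : ℝ} (hlam : 1 < lam) {x y : TMC M} (k : ℕ) :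
    y ∈ locStable lam x (lam ^ (-(k : ℤ))) ↔ ∀ i : ℤ, -k ≤ i → x.1 i = y.1 i := by
  rw [locStable, Set.mem_ofPred_eq, dlam_lt_zpow_iff hlam, bracket_eq_right_iff]
  constructor
  · rintro ⟨h, h'⟩ i hi
    by_cases h0 : 0 ≤ i
    · exact h' i h0
    · exact h i (abs_le.mpr ⟨hi, by omega⟩)
  · intro h
    exact ⟨fun i hi => h i (abs_le.mp hi).1, fun i hi => h i (by omega)⟩

theorem mem_locUnstable_iff {lam : ℝ} (hlam : 1 < lam) {x y : TMC M} (k : ℕ) :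
    y ∈ locUnstable lam x (lam ^ (-(k : ℤ))) ↔ ∀ i : ℤ, i ≤ k → x.1 i = y.1 i := by
  rw [locUnstable, Set.mem_ofPred_eq, dlam_lt_zpow_iff hlam]
  constructor
  · rintro ⟨h, h'⟩ i hi
    rw [bracket_eq_left_iff (h 0 (by simp)).symm] at h'
    by_cases h0 : i ≤ 0
    · exact h' i h0
    · exact h i (abs_le.mpr ⟨by omega, hi⟩)
  · intro h
    refine ⟨fun i hi => h i (abs_le.mp hi).2, ?_⟩
    rw [bracket_eq_left_iff (h 0 (by omega)).symm]
    exact fun i hi => h i (by omega)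

theorem mem_locUnstable_inv_iff {lam : ℝ} (hlam : 1 < lam) {x y : TMC M} :
    y ∈ locUnstable lam x lam⁻¹ ↔ ∀ i : ℤ, i ≤ 1 → x.1 i = y.1 i := by
  simpa using mem_locUnstable_iff hlam (x := x) (y := y) 1

theorem shift_iterate_mem_locStable_iff {lam : ℝ} (hlam : 1 < lam) {x y : TMC M} (N : ℕ) :
    (shift M)^[N] y ∈ locStable lam ((shift M)^[N] x) lam⁻¹ ↔
      ∀ i : ℤ, N - 1 ≤ i → x.1 i = y.1 i := by
  have h := mem_locStable_iff hlam (x := (shift M)^[N] x) (y := (shift M)^[N] y) 1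
  simp only [Nat.cast_one, zpow_neg_one, shift_iterate_apply] at h
  rw [h]
  constructor
  · intro h i hi
    simpa using h (i - N) (by omega)
  · exact fun h i hi => h _ (by omega)

theorem cs_eq_sInf {lam : ℝ} (hlam : 1 < lam) (a : TMC M × TMC M) :
    cs lam a = sInf {N : ℕ | ∀ i : ℤ, N - 1 ≤ i → a.1.1 i = a.2.1 i} := by
  simp only [cs, shift_iterate_mem_locStable_iff hlam]

theorem cs_congr {lam : ℝ} (hlam : 1 < lam) {a b : TMC M × TMC M}
    (h : ∀ i, a.1.1 i = a.2.1 i ↔ b.1.1 i = b.2.1 i) : cs lam a = cs lam b := by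
  simp only [cs_eq_sInf hlam, h]

/-- Stably equivalent points agree from some coordinate on. -/
theorem exists_forall_apply_eq {lam : ℝ} (hlam : 1 < lam) {x y : TMC M}
    (h : y ∈ globStable lam x) : ∃ N : ℕ, ∀ i : ℤ, N - 1 ≤ i → x.1 i = y.1 i := by
  have hev : ∀ᶠ n : ℕ in Filter.atTop,
      dlam lam ((shift M)^[n] x) ((shift M)^[n] y) < lam ^ (-((0 : ℕ) : ℤ)) :=
    Filter.Tendsto.eventually_lt_const (by positivity) h
  obtain ⟨N, hN⟩ := Filter.eventually_atTop.mp hev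
  refine ⟨N + 1, fun i hi => ?_⟩
  push_cast at hi
  have h := (dlam_lt_zpow_iff hlam _ _ 0).mp (hN i.toNat (by omega)) 0 (by simp)
  rw [shift_iterate_apply, shift_iterate_apply] at h
  rwa [zero_add, Int.toNat_of_nonneg (by omega)] at h

theorem apply_eq_of_cs_le {lam : ℝ} (hlam : 1 < lam) {c : TMC M × TMC M}
    (hc : c.2 ∈ globStable lam c.1) {n : ℕ} (hn : cs lam c ≤ n) {i : ℤ} (hi : n - 1 ≤ i) :
    c.1.1 i = c.2.1 i := by
  have h := Nat.sInf_mem (s := {N : ℕ | ∀ i : ℤ, N - 1 ≤ i → c.1.1 i = c.2.1 i})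
    (exists_forall_apply_eq hlam hc)
  rw [← cs_eq_sInf hlam] at h
  exact h i (by omega)

theorem holS_apply {n : ℕ} {x z : TMC M} (h : z.1 n = x.1 n) (i : ℤ) :
    (holS n x z).1 i = if i ≤ n then x.1 i else z.1 i := by
  rw [holS, shiftInv_iterate_apply, bracket_apply (by simpa [shift_iterate_apply] using h)]
  simp [shift_iterate_apply]

theorem mem_Vs_iff {lam : ℝ} (hlam : 1 < lam) {c a : TMC M × TMC M} {n : ℕ}
    (hcn : c.1.1 n = c.2.1 n) :
    a ∈ Vs lam c (lam ^ (-(n : ℤ) - 1)) n ↔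
      (∀ i : ℤ, i ≤ n + 1 → c.2.1 i = a.2.1 i) ∧
        ∀ i : ℤ, a.1.1 i = if i ≤ n then c.1.1 i else a.2.1 i := by
  have hexp : -(n : ℤ) - 1 = -((n + 1 : ℕ) : ℤ) := by push_cast; ring
  rw [Vs, Set.mem_ofPred_eq, hexp, mem_locUnstable_iff hlam]
  push_cast
  refine and_congr_right fun h => ?_
  have h0 : a.2.1 n = c.1.1 n := by rw [hcn, h n (by omega)]
  constructor
  · intro h1 i
    rw [h1, holS_apply h0]
  · intro h1
    exact ext_apply fun i => by rw [h1, holS_apply h0]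

theorem cs_eq_of_mem_Vs {lam : ℝ} (hlam : 1 < lam) {c a : TMC M × TMC M}
    (hc : c.2 ∈ globStable lam c.1) {n : ℕ} (hn : cs lam c ≤ n)
    (ha : a ∈ Vs lam c (lam ^ (-(n : ℤ) - 1)) n) : cs lam a = cs lam c := by
  obtain ⟨h2, h1⟩ := (mem_Vs_iff hlam (apply_eq_of_cs_le hlam hc hn (by omega))).mp ha
  refine cs_congr hlam fun i => ?_
  rw [h1]
  split_ifs with hi
  · rw [h2 i (by omega)]
  · exact iff_of_true rfl (apply_eq_of_cs_le hlam hc hn (by omega))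

/-- The source map is isometric on base sets. -/
theorem Dsl_eq_DslUnits_of_mem_Vs {lam : ℝ} (hlam : 1 < lam) {c a b : TMC M × TMC M}
    (hc : c.2 ∈ globStable lam c.1) {n : ℕ} (hn : cs lam c ≤ n)
    (ha : a ∈ Vs lam c (lam ^ (-(n : ℤ) - 1)) n)
    (hb : b ∈ Vs lam c (lam ^ (-(n : ℤ) - 1)) n) :
    Dsl lam a b = DslUnits lam a.2 b.2 := by
  have hcn : c.1.1 n = c.2.1 n := apply_eq_of_cs_le hlam hc hn (by omega)
  have hcs : cs lam a = cs lam b :=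
    (cs_eq_of_mem_Vs hlam hc hn ha).trans (cs_eq_of_mem_Vs hlam hc hn hb).symm
  obtain ⟨ha2, ha1⟩ := (mem_Vs_iff hlam hcn).mp ha
  obtain ⟨hb2, hb1⟩ := (mem_Vs_iff hlam hcn).mp hb
  have hab2 : ∀ i : ℤ, i ≤ n + 1 → a.2.1 i = b.2.1 i := fun i hi =>
    (ha2 i hi).symm.trans (hb2 i hi)
  have hab1 : ∀ i : ℤ, a.2.1 i = b.2.1 i → a.1.1 i = b.1.1 i := fun i hi => by
    rw [ha1, hb1, hi]
  have hu2 : b.2 ∈ locUnstable lam a.2 lam⁻¹ :=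
    (mem_locUnstable_inv_iff hlam).mpr fun i hi => hab2 i (by omega)
  have hu1 : b.1 ∈ locUnstable lam a.1 lam⁻¹ :=
    (mem_locUnstable_inv_iff hlam).mpr fun i hi => hab1 i (hab2 i (by omega))
  rw [Dsl, if_pos hcs, dsl, if_pos ⟨hu2, hu1⟩, DslUnits, if_pos hu2,
    max_eq_right (dlam_le_dlam hlam hab1)]

theorem cs_swap {lam : ℝ} (hlam : 1 < lam) (a : TMC M × TMC M) :
    cs lam (a.2, a.1) = cs lam a :=
  cs_congr hlam fun _ => eq_comm

theorem dsl_swap (lam : ℝ) (a b : TMC M × TMC M) :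
    dsl lam (a.2, a.1) (b.2, b.1) = dsl lam a b := by
  simp only [dsl, and_comm, max_comm]

/-- The inversion is isometric. -/
theorem Dsl_swap {lam : ℝ} (hlam : 1 < lam) (a b : TMC M × TMC M) :
    Dsl lam (a.2, a.1) (b.2, b.1) = Dsl lam a b := by
  simp only [Dsl, cs_swap hlam, dsl_swap]

end TMC

open TMC in
/-- In an irreducible topological Markov chain with stable groupoid
`G^s(Q)` and ultrametric `D_{s,λ}`: (1) on every base set `V^s(c, λ^{-n-1}, n)` with
`n ≥ c_s(c)` the source map `(x,y) ↦ y` is an isometry onto its image, where the unit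
space carries `D̃_{s,λ}`; (2) the inversion `(x,y) ↦ (y,x)` is an isometry of
`(G^s(Q), D_{s,λ})`. -/
theorem tmc_source_and_inversion_isometric {m : ℕ} (hm : 1 ≤ m)
    (M : Fin m → Fin m → Bool) (lam : ℝ) (hlam : 1 < lam)
    (hirr : ∀ U V : Set (TMC M), IsOpen U → IsOpen V → U.Nonempty → V.Nonempty →
      ∃ n : ℕ, ((shift M)^[n] '' U ∩ V).Nonempty)
    (q : TMC M) (hq : ∃ n : ℕ, 1 ≤ n ∧ (shift M)^[n] q = q) :
    (∀ c ∈ GsQ lam q, ∀ n : ℕ, cs lam c ≤ n →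
      ∀ a ∈ Vs lam c (lam ^ (-(n : ℤ) - 1)) n, ∀ b ∈ Vs lam c (lam ^ (-(n : ℤ) - 1)) n,
        Dsl lam a b = DslUnits lam a.2 b.2) ∧
    (∀ a ∈ GsQ lam q, ∀ b ∈ GsQ lam q,
      Dsl lam (a.2, a.1) (b.2, b.1) = Dsl lam a b) := by
  exact ⟨fun c hc n hn a ha b hb => Dsl_eq_DslUnits_of_mem_Vs hlam hc.2.2 hn ha hb,
    fun a _ b _ => Dsl_swap hlam a b⟩
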